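/- (Arc-length claim from the proof of Lemma 2.2) Fix j ∈ {1,…,m−1} and set r_j := |η₀ − u_j| and R_j := √(r_j² + v_j²). For every r with √2 · r_j < r < R_j, the connected component γ(r) of {w ∈ G : |w − η₀| = r} that contains a point of the vertical ray {η₀ + it : t > 0} has length (one-dimensional Hausdorff measure) at most (3/4)·π·r. -/

import Mathlib

open MeasureTheory

/-- An arc of a circle of radius `R` has length at most `|R|` times its opening angle. -/
theorem hausdorffMeasure_circleMap_image_Icc_le (c : ℂ) (R a b : ℝ) :
    (Measure.hausdorffMeasure 1 : Measure ℂ) (circleMap c R '' Set.Icc a b) ≤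
      ENNReal.ofReal (|R| * (b - a)) := by
  have h := (lipschitzWith_circleMap c R).hausdorffMeasure_image_le zero_le_one (Set.Icc a b)
  rw [hausdorffMeasure_real, Real.volume_Icc, ENNReal.rpow_one] at h
  rw [ENNReal.ofReal_mul (abs_nonneg R)]
  convert h using 2
  rw [← Real.coe_nnabs, ENNReal.ofReal_coe_nnreal]

/-- A preconnected set that misses a vertical line lies on one side of it. -/
theorem IsPreconnected.re_lt_of_forall_re_ne {S : Set ℂ} (hS : IsPreconnected S) {a : ℝ}
    (ha : ∀ w ∈ S, w.re ≠ a) {p : ℂ} (hp : p ∈ S) (hpa : p.re < a) :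
    ∀ w ∈ S, w.re < a := by
  intro w hw
  by_contra! hwa
  obtain ⟨z, hz, hza⟩ :=
    hS.intermediate_value hp hw Complex.continuous_re.continuousOn ⟨hpa.le, hwa⟩
  exact ha z hz hza

/-- A preconnected set that misses a vertical line lies on one side of it. -/
theorem IsPreconnected.lt_re_of_forall_re_ne {S : Set ℂ} (hS : IsPreconnected S) {a : ℝ}
    (ha : ∀ w ∈ S, w.re ≠ a) {p : ℂ} (hp : p ∈ S) (hpa : a < p.re) :
    ∀ w ∈ S, a < w.re := by
  intro w hw
  by_contra! hwa
  obtain ⟨z, hz, hza⟩ :=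
    hS.intermediate_value hw hp Complex.continuous_re.continuousOn ⟨hwa, hpa.le⟩
  exact ha z hz hza

/-- A point of the upper half circle is parametrised by an angle in `[0, π]`. -/
theorem exists_mem_Icc_circleMap_eq {x r : ℝ} {w : ℂ} (hw : w ∈ Metric.sphere (x : ℂ) r)
    (him : 0 ≤ w.im) : ∃ θ ∈ Set.Icc 0 Real.pi, circleMap x r θ = w ∧ w.re = x + r * Real.cos θ := by
  have hnorm : ‖w - x‖ = r := mem_sphere_iff_norm.1 hw
  have heq : circleMap x r (w - x).arg = w := by
    rw [circleMap, ← hnorm, Complex.norm_mul_exp_arg_mul_I, add_sub_cancel]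
  refine ⟨(w - x).arg, ⟨Complex.arg_nonneg_iff.2 (by simpa using him), Complex.arg_le_pi _⟩, heq, ?_⟩
  have := Complex.norm_mul_cos_arg (w - x)
  rw [hnorm, Complex.sub_re, Complex.ofReal_re] at this
  linarith

theorem Real.cos_three_mul_pi_div_four : Real.cos (3 * Real.pi / 4) = -(√2 / 2) := by
  rw [show 3 * Real.pi / 4 = Real.pi - Real.pi / 4 by ring, Real.cos_pi_sub, Real.cos_pi_div_four]

/-- If the tip of a vertical slit of height `b` over `a` is not inside a circle centred on the real
line, then the upper half circle can meet the line `re = a` only in the slit. -/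
theorem mem_segment_of_mem_sphere {x a b r : ℝ} (hb : 0 < b)
    (hr : r ≤ √((x - a) ^ 2 + b ^ 2)) {w : ℂ} (hw : w ∈ Metric.sphere (x : ℂ) r)
    (him : 0 ≤ w.im) (hre : w.re = a) :
    w ∈ segment ℝ (a : ℂ) ((a : ℂ) + (b : ℂ) * Complex.I) := by
  have hnorm : ‖w - x‖ = r := mem_sphere_iff_norm.1 hw
  have hsq : r ^ 2 = (a - x) ^ 2 + w.im ^ 2 := by
    rw [← hnorm, Complex.sq_norm, Complex.normSq_apply]
    simp [hre]
    ring
  have hle : r ^ 2 ≤ (x - a) ^ 2 + b ^ 2 := by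
    rw [← Real.sq_sqrt (by positivity : 0 ≤ (x - a) ^ 2 + b ^ 2)]
    exact pow_le_pow_left₀ (hnorm ▸ norm_nonneg _) hr 2
  have hwb : w.im ≤ b := by
    apply le_of_sq_le_sq _ hb.le
    nlinarith
  rw [segment_eq_image']
  refine ⟨w.im / b, ⟨by positivity, (div_le_one hb).2 hwb⟩, ?_⟩
  apply Complex.ext <;> simp [hre, hb.ne']

/-- **Arc-length claim from the proof of Lemma 2.2.** For the comb domain `G` and
`η₀ ∈ (0, π)` with `η₀ ∉ {u₁, …, u_{m-1}}`, fix `j ∈ {1, …, m-1}` and set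
`r_j := |η₀ - u_j|`, `R_j := √(r_j² + v_j²)`. For every `r` with `√2 ⬝ r_j < r < R_j`,
the connected component `γ(r)` of `{w ∈ G : |w - η₀| = r}` containing a point of the
vertical ray `{η₀ + i t : t > 0}` (namely the point `η₀ + i r`) has one-dimensional
Hausdorff measure at most `(3/4) π r`. -/
theorem statement6
    (m : ℕ) (hm : 1 < m) (u v : ℕ → ℝ)
    (hu0 : u 0 = 0) (hum : u m = Real.pi)
    (humono : StrictMonoOn u (Set.Icc 0 m))
    (hv : ∀ j ∈ Finset.Icc 1 (m - 1), 0 < v j)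
    (G : Set ℂ)
    (hG : G = {z : ℂ | 0 < z.re ∧ z.re < Real.pi ∧ 0 < z.im} \
      ⋃ j ∈ Finset.Icc 1 (m - 1), segment ℝ ((u j : ℂ)) ((u j : ℂ) + (v j : ℂ) * Complex.I))
    (η₀ : ℝ) (hη₀ : η₀ ∈ Set.Ioo 0 Real.pi)
    (hη₀u : ∀ j ∈ Finset.Icc 1 (m - 1), η₀ ≠ u j)
    (j : ℕ) (hj : j ∈ Finset.Icc 1 (m - 1))
    (rj : ℝ) (hrj : rj = |η₀ - u j|)
    (Rj : ℝ) (hRj : Rj = Real.sqrt (rj ^ 2 + (v j) ^ 2)) :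
    ∀ r : ℝ, Real.sqrt 2 * rj < r → r < Rj →
      (Measure.hausdorffMeasure 1 : Measure ℂ)
          (connectedComponentIn (G ∩ Metric.sphere (η₀ : ℂ) r)
            ((η₀ : ℂ) + (r : ℂ) * Complex.I)) ≤
        ENNReal.ofReal (3 / 4 * Real.pi * r) := by
  intro r hr hrR
  subst hrj hRj
  set S := G ∩ Metric.sphere (η₀ : ℂ) r
  set p : ℂ := (η₀ : ℂ) + (r : ℂ) * Complex.I
  have hr0 : 0 < r := lt_of_le_of_lt (by positivity) hr
  have hcos : |η₀ - u j| < r * (√2 / 2) := by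
    have h2 : √2 * √2 = 2 := Real.mul_self_sqrt zero_le_two
    calc |η₀ - u j| = √2 * |η₀ - u j| * (√2 / 2) := by linear_combination -|η₀ - u j| / 2 * h2
      _ < r * (√2 / 2) := mul_lt_mul_of_pos_right hr (by positivity)
  rw [sq_abs] at hrR
  have him : ∀ w ∈ S, 0 ≤ w.im := by
    rintro w ⟨hw, -⟩
    rw [hG] at hw
    exact hw.1.2.2.le
  have hne : ∀ w ∈ connectedComponentIn S p, w.re ≠ u j := by
    intro w hw hre
    have hwS := connectedComponentIn_subset _ _ hw
    have hwG := hwS.1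
    rw [hG] at hwG
    exact hwG.2 (Set.mem_biUnion hj
      (mem_segment_of_mem_sphere (hv j hj) hrR.le hwS.2 (him w hwS) hre))
  by_cases hp : p ∈ S
  swap
  · simp [connectedComponentIn_eq_empty hp]
  have hpC := mem_connectedComponentIn hp
  have hpre : p.re = η₀ := by simp [p]
  suffices h : ∃ a b, b - a = 3 / 4 * Real.pi ∧
      connectedComponentIn S p ⊆ circleMap η₀ r '' Set.Icc a b by
    obtain ⟨a, b, hab, hsub⟩ := h
    refine (measure_mono hsub).trans
      ((hausdorffMeasure_circleMap_image_Icc_le _ _ _ _).trans_eq ?_)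
    rw [hab, abs_of_pos hr0, mul_comm]
  have hpi := Real.pi_pos
  rcases lt_or_gt_of_ne (hη₀u j hj) with hlt | hgt
  · refine ⟨Real.pi / 4, Real.pi, by ring, fun w hw => ?_⟩
    have hwu := isPreconnected_connectedComponentIn.re_lt_of_forall_re_ne hne hpC
      (hpre ▸ hlt) w hw
    have hwS := connectedComponentIn_subset _ _ hw
    obtain ⟨θ, hθ, rfl, hre⟩ := exists_mem_Icc_circleMap_eq hwS.2 (him w hwS)
    refine ⟨θ, ⟨?_, hθ.2⟩, rfl⟩
    by_contra! hθ4
    have hc := Real.cos_le_cos_of_nonneg_of_le_pi hθ.1 (by linarith) hθ4.le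
    rw [Real.cos_pi_div_four] at hc
    have := mul_le_mul_of_nonneg_left hc hr0.le
    rw [abs_of_neg (by linarith)] at hcos
    linarith
  · refine ⟨0, 3 * Real.pi / 4, by ring, fun w hw => ?_⟩
    have hwu := isPreconnected_connectedComponentIn.lt_re_of_forall_re_ne hne hpC
      (hpre ▸ hgt) w hw
    have hwS := connectedComponentIn_subset _ _ hw
    obtain ⟨θ, hθ, rfl, hre⟩ := exists_mem_Icc_circleMap_eq hwS.2 (him w hwS)
    refine ⟨θ, ⟨hθ.1, ?_⟩, rfl⟩
    by_contra! hθ4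
    have hc := Real.cos_le_cos_of_nonneg_of_le_pi (by positivity) hθ.2 hθ4.le
    rw [Real.cos_three_mul_pi_div_four] at hc
    have := mul_le_mul_of_nonneg_left hc hr0.le
    rw [abs_of_pos (by linarith)] at hcos
    linarith
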